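/- arXiv:2107.03782 — 4 statements merged into one kernel-verified Lean document; each statement's English description precedes it below -/
import Mathlib

section
/- Let K be a locally compact Hausdorff topological space which is not σ-compact and such that every countable family of compact subsets of K is contained in a single compact subset of K. Then C₀(K), regarded as a module over itself, is not countably generated: there is no countable set S ⊆ C₀(K) such that the set of all finite module linear combinations of elements of S (finite sums ∑ᵢ xᵢ·aᵢ with xᵢ ∈ S and aᵢ coefficients, including complex scalar multiples of elements of S) is dense in C₀(K). Equivalently, for every countable set S ⊆ C₀(K) there exists f ∈ C₀(K) outside the closure of the linear span of such products, because all elements of that closure vanish outside a common compact set while f does not. -/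
open scoped ZeroAtInfty

/-- Let `K` be a locally compact Hausdorff space which is not σ-compact and
such that every countable family of compact subsets of `K` is contained in a single compact
subset. Then `C₀(K)`, as a module over itself, is not countably generated: for every
countable set `S ⊆ C₀(K)`, the set of finite module linear combinations of elements of `S`
(finite sums of complex scalar multiples of elements of `S` and of products `x·a` with
`x ∈ S`, `a ∈ C₀(K)`) is not dense in `C₀(K)`. -/
theorem C0_not_countablyGenerated {K : Type*} [TopologicalSpace K]
    [LocallyCompactSpace K] [T2Space K]
    (hσ : ¬ SigmaCompactSpace K)
    (hcc : ∀ F : ℕ → Set K, (∀ n, IsCompact (F n)) →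
      ∃ C : Set K, IsCompact C ∧ ∀ n, F n ⊆ C)
    (S : Set C₀(K, ℂ)) (hS : S.Countable) :
    ¬ Dense (↑(Submodule.span ℂ
        (S ∪ {y : C₀(K, ℂ) | ∃ x ∈ S, ∃ a : C₀(K, ℂ), y = x * a})) : Set C₀(K, ℂ)) := by
  intro hD
  -- enumerate `S`, adding `0` to make it nonempty
  obtain ⟨u, hu⟩ := (hS.insert (0 : C₀(K, ℂ))).exists_eq_range (Set.insert_nonempty _ _)
  have hcpt : ∀ n m : ℕ, ∃ t : Set K, IsCompact t ∧
      ∀ x, x ∉ t → ‖u n x‖ < 1 / ((m : ℝ) + 1) := by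
    intro n m
    have h1 : ∀ᶠ x in Filter.cocompact K, dist (u n x) 0 < 1 / ((m : ℝ) + 1) :=
      Metric.tendsto_nhds.1 (u n).zero_at_infty' _ (by positivity)
    obtain ⟨t, ht, hts⟩ := Filter.mem_cocompact.1 h1
    refine ⟨t, ht, fun x hx => ?_⟩
    have := hts hx
    simpa using this
  choose t ht htx using hcpt
  obtain ⟨C, hC, hCt⟩ := hcc (fun k => t k.unpair.1 k.unpair.2) (fun k => ht _ _)
  have hne : ∃ p : K, p ∉ C := by
    by_contra! h
    exact hσ (@CompactSpace.sigmaCompact K _ ⟨by rwa [← Set.eq_univ_of_forall h]⟩)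
  obtain ⟨p, hp⟩ := hne
  have hu0 : ∀ n, u n p = 0 := by
    intro n
    by_contra h
    obtain ⟨m, hm⟩ := exists_nat_one_div_lt (norm_pos_iff.2 h)
    have hpt : p ∉ t n m := fun h' => hp (hCt (Nat.pair n m) (by simpa using h'))
    exact lt_asymm hm (htx n m p hpt)
  have hS0 : ∀ x ∈ S, x p = 0 := by
    intro x hx
    have : x ∈ Set.range u := hu ▸ Set.mem_insert_of_mem _ hx
    obtain ⟨n, rfl⟩ := this
    exact hu0 n
  have hspan : ∀ g ∈ Submodule.span ℂ
      (S ∪ {y : C₀(K, ℂ) | ∃ x ∈ S, ∃ a : C₀(K, ℂ), y = x * a}), g p = 0 := by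
    intro g hg
    induction hg using Submodule.span_induction with
    | mem x hx =>
      rcases hx with hx | ⟨y, hy, a, rfl⟩
      · exact hS0 x hx
      · simp [hS0 y hy]
    | zero => simp
    | add x y _ _ hx hy => simp [hx, hy]
    | smul c x _ hx => simp [hx]
  obtain ⟨f, hf1, -, hfc, -⟩ := exists_continuous_one_zero_of_isCompact
    (isCompact_singleton (x := p)) isClosed_empty (Set.disjoint_empty _)
  have hfc' : HasCompactSupport (fun x => (f x : ℂ)) :=
    hfc.comp_left (g := fun r : ℝ => (r : ℂ)) Complex.ofReal_zero
  let F : C₀(K, ℂ) :=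
    { toFun := fun x => (f x : ℂ)
      continuous_toFun := by fun_prop
      zero_at_infty' := hfc'.is_zero_at_infty }
  obtain ⟨g, hg, hgd⟩ := hD.exists_dist_lt F one_pos
  have h2 : dist (F p) (g p) ≤ dist F g := by
    rw [← ZeroAtInftyContinuousMap.dist_toBCF_eq_dist]
    exact BoundedContinuousFunction.dist_coe_le_dist (f := F.toBCF) (g := g.toBCF) p
  have h3 : F p = 1 := by
    change ((f p : ℝ) : ℂ) = 1
    rw [hf1 rfl]; simp
  rw [h3, hspan g hg] at h2
  simp at h2
  linarith
end

section
/- Let K be a locally compact Hausdorff topological space which is not σ-compact and such that every countable family of compact subsets of K is contained in a single compact subset of K. Let μ be a positive continuous linear functional on C₀(K) (equivalently, a countably additive positive finite Radon measure on K). Then μ has compact support: there exists a compact set K′ ⊆ K such that μ(f) = ∫_K f dμ = 0 for every f ∈ C₀(K) with f(t) = 0 for all t ∈ K′. -/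
open scoped ZeroAtInfty ComplexOrder


theorem aux_compact {K : Type*} [TopologicalSpace K]
    (hcc : ∀ F : ℕ → Set K, (∀ n, IsCompact (F n)) →
      ∃ C : Set K, IsCompact C ∧ ∀ n, F n ⊆ C) (g : C₀(K, ℂ)) :
    ∃ C : Set K, IsCompact C ∧ ∀ t, t ∉ C → g t = 0 := by
  have h : ∀ n : ℕ, ∃ F : Set K, IsCompact F ∧ ∀ t, t ∉ F → ‖g t‖ < 1 / ((n : ℝ) + 1) := by
    intro n
    have h1 := g.zero_at_infty'
    have h2 := h1.norm
    have h3 : ∀ᶠ t in Filter.cocompact K, ‖g t‖ < 1 / ((n : ℝ) + 1) := by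
      refine h2.eventually_lt_const ?_
      rw [norm_zero]
      positivity
    obtain ⟨F, hF, hs⟩ := Filter.mem_cocompact.1 h3
    exact ⟨F, hF, fun t ht => hs ht⟩
  choose F hF hs using h
  obtain ⟨C, hC, hFC⟩ := hcc F hF
  refine ⟨C, hC, fun t ht => ?_⟩
  by_contra hne
  obtain ⟨n, hn⟩ := exists_nat_one_div_lt (norm_pos_iff.2 hne)
  exact lt_asymm hn (hs n t (fun h => ht (hFC n h)))

/-- The pointwise absolute value of a function vanishing at infinity. -/
noncomputable def auxAbs {K : Type*} [TopologicalSpace K] (f : C₀(K, ℂ)) : C₀(K, ℂ) where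
  toFun t := ((‖f t‖ : ℝ) : ℂ)
  continuous_toFun := Complex.continuous_ofReal.comp f.continuous.norm
  zero_at_infty' := by
    have h := f.zero_at_infty'.norm
    rw [norm_zero] at h
    have h2 := (Complex.continuous_ofReal.tendsto 0).comp h
    rw [Complex.ofReal_zero] at h2
    exact h2

theorem auxAbs_apply {K : Type*} [TopologicalSpace K] (f : C₀(K, ℂ)) (t : K) :
    auxAbs f t = ((‖f t‖ : ℝ) : ℂ) := rfl

theorem aux_norm_le {K : Type*} [TopologicalSpace K] (f : C₀(K, ℂ)) (t : K) :
    ‖f t‖ ≤ ‖f‖ := by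
  rw [← ZeroAtInftyContinuousMap.norm_toBCF_eq_norm]
  exact f.toBCF.norm_coe_le_norm t

/-- Let `K` be a locally compact Hausdorff space which is not σ-compact and
such that every countable family of compact subsets of `K` is contained in a single compact
subset. Let `μ` be a positive continuous linear functional on `C₀(K)` (equivalently, a
positive finite Radon measure on `K`). Then `μ` has compact support: there exists a compact
set `K' ⊆ K` such that `μ f = 0` for every `f ∈ C₀(K)` vanishing on `K'`. -/
theorem positive_functional_compact_support {K : Type*} [TopologicalSpace K]
    [LocallyCompactSpace K] [T2Space K]
    (hσ : ¬ SigmaCompactSpace K)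
    (hcc : ∀ F : ℕ → Set K, (∀ n, IsCompact (F n)) →
      ∃ C : Set K, IsCompact C ∧ ∀ n, F n ⊆ C)
    (μ : C₀(K, ℂ) →L[ℂ] ℂ)
    (hpos : ∀ f : C₀(K, ℂ), (∀ t : K, 0 ≤ f t) → 0 ≤ μ f) :
    ∃ K' : Set K, IsCompact K' ∧
      ∀ f : C₀(K, ℂ), (∀ t ∈ K', f t = 0) → μ f = 0 := by
  classical
  let A : Set ℝ := {x | ∃ g : C₀(K, ℂ), (∀ t, 0 ≤ g t ∧ g t ≤ 1) ∧ x = (μ g).re}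
  have hA0 : A.Nonempty := ⟨0, 0, by simp, by simp⟩
  have hAb : BddAbove A := by
    refine ⟨‖μ‖, ?_⟩
    rintro x ⟨g, hg, rfl⟩
    have hg1 : ‖g‖ ≤ 1 := by
      rw [← ZeroAtInftyContinuousMap.norm_toBCF_eq_norm]
      refine (BoundedContinuousFunction.norm_le zero_le_one).2 fun t => ?_
      have := CStarAlgebra.norm_le_norm_of_nonneg_of_le (hg t).1 (hg t).2
      simpa using this
    calc (μ g).re ≤ ‖μ g‖ := Complex.re_le_norm _
      _ ≤ ‖μ‖ * ‖g‖ := μ.le_opNorm g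
      _ ≤ ‖μ‖ := mul_le_of_le_one_right μ.opNorm_nonneg hg1
  have hex : ∀ n : ℕ, ∃ g : C₀(K, ℂ), (∀ t, 0 ≤ g t ∧ g t ≤ 1) ∧
      sSup A - 1 / ((n : ℝ) + 1) < (μ g).re := by
    intro n
    have hp : (0 : ℝ) < 1 / ((n : ℝ) + 1) := by positivity
    obtain ⟨x, ⟨g, hg, rfl⟩, hx⟩ := exists_lt_of_lt_csSup hA0 (sub_lt_self (sSup A) hp)
    exact ⟨g, hg, hx⟩
  choose g hg hgs using hex
  choose F hF hFg using fun n => aux_compact hcc (g n)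
  obtain ⟨C, hC, hFC⟩ := hcc F hF
  have hgC : ∀ n t, t ∉ C → g n t = 0 := fun n t ht => hFg n t fun h => ht (hFC n h)
  refine ⟨C, hC, ?_⟩
  -- the absolute value of a function vanishing on `C` is annihilated
  have habs : ∀ f : C₀(K, ℂ), (∀ t ∈ C, f t = 0) → μ (auxAbs f) = 0 := by
    intro f hf
    have h0 : 0 ≤ μ (auxAbs f) := hpos _ fun t => by
      rw [auxAbs_apply]; exact_mod_cast norm_nonneg _
    obtain ⟨hre, him⟩ := Complex.le_def.1 h0
    have hc : (0 : ℝ) < 1 / (‖f‖ + 1) := by positivity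
    set c : ℝ := 1 / (‖f‖ + 1) with hcdef
    have hle : ∀ n : ℕ, c * (μ (auxAbs f)).re < 1 / ((n : ℝ) + 1) := by
      intro n
      have hmem : (μ (g n + (c : ℂ) • auxAbs f)).re ∈ A := by
        refine ⟨_, fun t => ?_, rfl⟩
        have e : (g n + (c : ℂ) • auxAbs f) t = g n t + ((c * ‖f t‖ : ℝ) : ℂ) := by
          simp [auxAbs_apply]
        rw [e]
        by_cases ht : t ∈ C
        · rw [hf t ht]; simpa using hg n t
        · rw [hgC n t ht, zero_add]
          have h1 : 0 ≤ c * ‖f t‖ := by positivity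
          have h2 : c * ‖f t‖ ≤ 1 := by
            rw [hcdef, one_div, inv_mul_le_iff₀ (by positivity)]
            have := aux_norm_le f t
            linarith
          exact ⟨by exact_mod_cast h1, by exact_mod_cast h2⟩
      have h1 := le_csSup hAb hmem
      have h2 := hgs n
      have e2 : (μ (g n + (c : ℂ) • auxAbs f)).re = (μ (g n)).re + c * (μ (auxAbs f)).re := by
        rw [map_add, map_smul, Complex.add_re, smul_eq_mul, Complex.re_ofReal_mul]
      rw [e2] at h1
      linarith
    have hz : (μ (auxAbs f)).re = 0 := by
      by_contra hne
      have hp : 0 < (μ (auxAbs f)).re := lt_of_le_of_ne hre (Ne.symm hne)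
      obtain ⟨n, hn⟩ := exists_nat_one_div_lt (mul_pos hc hp)
      exact lt_asymm hn (hle n)
    exact Complex.ext hz him.symm
  -- real functions
  have hreal : ∀ r : C₀(K, ℂ), (∀ t, (r t).im = 0) → (∀ t ∈ C, r t = 0) → μ r = 0 := by
    intro r hr hrC
    have hb := habs r hrC
    have h1 : 0 ≤ μ (auxAbs r + r) := hpos _ fun t => by
      have e : (auxAbs r + r) t = ((‖r t‖ : ℝ) : ℂ) + r t := rfl
      rw [e, Complex.le_def]
      have := (abs_le.1 (Complex.abs_re_le_norm (r t))).1
      constructor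
      · simp; linarith
      · simp [hr t]
    have h2 : 0 ≤ μ (auxAbs r - r) := hpos _ fun t => by
      have e : (auxAbs r - r) t = ((‖r t‖ : ℝ) : ℂ) - r t := rfl
      rw [e, Complex.le_def]
      have := (abs_le.1 (Complex.abs_re_le_norm (r t))).2
      constructor
      · simp; linarith
      · simp [hr t]
    rw [map_add, hb, zero_add] at h1
    rw [map_sub, hb, zero_sub] at h2
    exact le_antisymm (neg_nonneg.1 h2) h1
  intro f hf
  have ha := hreal (f + star f) (fun t => by simp) (fun t ht => by simp [hf t ht])
  have hb := hreal (Complex.I • (f - star f)) (fun t => by simp) (fun t ht => by simp [hf t ht])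
  rw [map_add] at ha
  rw [map_smul, map_sub, smul_eq_mul] at hb
  have hb' := (mul_eq_zero.1 hb).resolve_left Complex.I_ne_zero
  linear_combination (ha + hb') / 2
end

section
/- Let K be a locally compact Hausdorff space and let (x_j)_{j∈J} be a standard frame in C₀(K) with frame bounds c₁, c₂ > 0. Then for every point z ∈ K the family (|x_j(z)|²)_{j∈J} is summable and c₁ ≤ ∑_{j∈J} |x_j(z)|² ≤ c₂. In particular, for every z ∈ K the set {j ∈ J : x_j(z) ≠ 0} is nonempty and at most countable. -/
open scoped ZeroAtInfty
open Filter

/-- A family `(x_j)_{j ∈ J}` of elements of `C₀(K)` is a standard frame with frame bounds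
`c₁, c₂` if for every `f ∈ C₀(K)` the net of finite partial sums of
`∑_j ⟨f, x_j⟩⟨x_j, f⟩ = ∑_j |x_j|²·|f|²` converges in the supremum norm (i.e. uniformly)
to a function `S` with `c₁·|f|² ≤ S ≤ c₂·|f|²` pointwise. -/
def IsStandardFrame {K : Type*} [TopologicalSpace K] {J : Type*}
    (x : J → C₀(K, ℂ)) (c₁ c₂ : ℝ) : Prop :=
  ∀ f : C₀(K, ℂ), ∃ S : K → ℝ,
    TendstoUniformly
      (fun (s : Finset J) (t : K) => ∑ j ∈ s, ‖x j t‖ ^ 2 * ‖f t‖ ^ 2) S atTop ∧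
    ∀ t : K, c₁ * ‖f t‖ ^ 2 ≤ S t ∧ S t ≤ c₂ * ‖f t‖ ^ 2

/-- If `(x_j)_{j ∈ J}` is a standard frame in `C₀(K)` (for `K` locally
compact Hausdorff) with frame bounds `c₁, c₂ > 0`, then for every point `z ∈ K` the family
`(|x_j(z)|²)_j` is summable with `c₁ ≤ ∑_j |x_j(z)|² ≤ c₂`; in particular the set
`{j : x_j(z) ≠ 0}` is nonempty and at most countable. -/
theorem frame_pointwise_bounds {K : Type*} [TopologicalSpace K] [LocallyCompactSpace K]
    [T2Space K] {J : Type*} (x : J → C₀(K, ℂ)) (c₁ c₂ : ℝ)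
    (hc₁ : 0 < c₁) (hc₂ : 0 < c₂) (hx : IsStandardFrame x c₁ c₂) (z : K) :
    (Summable fun j : J => ‖x j z‖ ^ 2) ∧
    c₁ ≤ ∑' j : J, ‖x j z‖ ^ 2 ∧ (∑' j : J, ‖x j z‖ ^ 2) ≤ c₂ ∧
    {j : J | x j z ≠ 0}.Nonempty ∧ {j : J | x j z ≠ 0}.Countable := by
  obtain ⟨g, hg1, -, hgc, -⟩ := exists_continuous_one_zero_of_isCompact
    (isCompact_singleton (x := z)) isClosed_empty (Set.disjoint_empty _)
  have hgz : g z = 1 := hg1 rfl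
  have hgc' : HasCompactSupport (fun t => (g t : ℂ)) :=
    hgc.comp_left (g := fun r : ℝ => (r : ℂ)) Complex.ofReal_zero
  let f : C₀(K, ℂ) :=
    { toFun := fun t => (g t : ℂ)
      continuous_toFun := Complex.continuous_ofReal.comp g.continuous
      zero_at_infty' := hgc'.is_zero_at_infty }
  have hf : f z = 1 := by
    change ((g z : ℝ) : ℂ) = 1
    rw [hgz, Complex.ofReal_one]
  obtain ⟨S, hS, hb⟩ := hx f
  have h1 := hS.tendsto_at z
  have h2 := hb z
  simp only [hf, norm_one, one_pow, mul_one] at h1 h2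
  have hs : HasSum (fun j : J => ‖x j z‖ ^ 2) (S z) := h1
  refine ⟨hs.summable, hs.tsum_eq ▸ h2.1, hs.tsum_eq ▸ h2.2, ?_, ?_⟩
  · by_contra hne
    have h0 : ∀ j, x j z = 0 := by
      intro j
      by_contra hj
      exact hne ⟨j, hj⟩
    have h3 : S z = 0 := by
      rw [← hs.tsum_eq]
      simp [h0]
    linarith [h2.1]
  · have h4 := hs.summable.countable_support
    refine h4.mono ?_
    intro j hj
    simpa [Function.mem_support] using hj
end

section
/- Let K be a locally compact Hausdorff topological space which is not σ-compact and such that every countable family of compact subsets of K is contained in a single compact subset of K. Then there exists no standard frame in C₀(K): there is no index set J, no family (x_j)_{j∈J} of elements of C₀(K), and no constants c₁, c₂ > 0 such that for every f ∈ C₀(K) the series ∑_j |x_j|²·|f|² converges in the supremum norm and satisfies c₁·|f|² ≤ ∑_j |x_j|²·|f|² ≤ c₂·|f|² pointwise on K. -/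
open scoped ZeroAtInfty
open Filter

theorem aux_unif {K : Type*} [TopologicalSpace K] [LocallyCompactSpace K]
    [T2Space K] {J : Type} {x : J → C₀(K, ℂ)} {c₁ c₂ : ℝ} (hx : IsStandardFrame x c₁ c₂)
    {C : Set K} (hC : IsCompact C) :
    ∃ S : K → ℝ, (∀ t ∈ C, c₁ ≤ S t) ∧ ∀ ε > 0, ∃ s : Finset J, ∀ s', s ⊆ s' → ∀ t ∈ C,
      |S t - ∑ j ∈ s', ‖x j t‖ ^ 2| < ε := by
  obtain ⟨g, hg1, -, hgc, -⟩ := exists_continuous_one_zero_of_isCompact hC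
    isClosed_empty (Set.disjoint_empty C)
  let f : C₀(K, ℂ) :=
    { toFun := fun t => (g t : ℂ)
      continuous_toFun := by fun_prop
      zero_at_infty' := by
        have h : HasCompactSupport (fun t => (g t : ℂ)) :=
          hgc.comp_left (g := fun r : ℝ => (r : ℂ)) (by simp)
        exact h.is_zero_at_infty }
  have hf : ∀ t ∈ C, ‖f t‖ = 1 := by
    intro t ht
    have : f t = (g t : ℂ) := rfl
    rw [this, hg1 ht]; simp
  obtain ⟨S, hS, hb⟩ := hx f
  refine ⟨S, fun t ht => ?_, fun ε hε => ?_⟩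
  · have := (hb t).1
    rw [hf t ht] at this
    simpa using this
  · have := Metric.tendstoUniformly_iff.1 hS ε hε
    obtain ⟨s, hs⟩ := eventually_atTop.1 this
    refine ⟨s, fun s' h t ht => ?_⟩
    have := hs s' h t
    simpa [hf t ht, Real.dist_eq] using this

theorem aux_count {K : Type*} [TopologicalSpace K]
    (hcc : ∀ F : ℕ → Set K, (∀ n, IsCompact (F n)) →
      ∃ C : Set K, IsCompact C ∧ ∀ n, F n ⊆ C) {ι : Type*} [Countable ι]
    (F : ι → Set K) (hF : ∀ i, IsCompact (F i)) :
    ∃ C : Set K, IsCompact C ∧ ∀ i, F i ⊆ C := by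
  rcases isEmpty_or_nonempty ι with h | h
  · exact ⟨∅, isCompact_empty, fun i => h.elim i⟩
  · obtain ⟨e, he⟩ := exists_surjective_nat ι
    obtain ⟨C, hC, h⟩ := hcc (fun n => F (e n)) (fun n => hF _)
    refine ⟨C, hC, fun i => ?_⟩
    obtain ⟨n, rfl⟩ := he i
    exact h n

theorem aux_supp {K : Type*} [TopologicalSpace K]
    (hcc : ∀ F : ℕ → Set K, (∀ n, IsCompact (F n)) →
      ∃ C : Set K, IsCompact C ∧ ∀ n, F n ⊆ C) (f : C₀(K, ℂ)) :
    ∃ C : Set K, IsCompact C ∧ ∀ t, f t ≠ 0 → t ∈ C := by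
  have h : ∀ n : ℕ, ∃ C : Set K, IsCompact C ∧ ∀ t, t ∉ C → ‖f t‖ < 1 / ((n : ℝ) + 1) := by
    intro n
    have h1 := (zero_at_infty f).eventually (Metric.ball_mem_nhds 0 (ε := 1 / ((n : ℝ) + 1))
      (by positivity))
    obtain ⟨C, hC, h⟩ := mem_cocompact.1 h1
    refine ⟨C, hC, fun t ht => ?_⟩
    have := h ht
    simpa using this
  choose F hF h using h
  obtain ⟨C, hC, hs⟩ := hcc F hF
  refine ⟨C, hC, fun t ht => ?_⟩
  obtain ⟨n, hn⟩ := exists_nat_one_div_lt (norm_pos_iff.2 ht)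
  by_contra hc
  exact absurd (h n t (fun h' => hc (hs n h'))) (not_lt.2 hn.le)

theorem aux_step {K : Type*} [TopologicalSpace K] [LocallyCompactSpace K]
    [T2Space K]
    (hσ : ¬ SigmaCompactSpace K)
    (hcc : ∀ F : ℕ → Set K, (∀ n, IsCompact (F n)) →
      ∃ C : Set K, IsCompact C ∧ ∀ n, F n ⊆ C)
    {J : Type} {x : J → C₀(K, ℂ)} {c₁ c₂ : ℝ} (hx : IsStandardFrame x c₁ c₂)
    (C : Set K) (hC : IsCompact C) :
    ∃ C' : Set K, IsCompact C' ∧ C ⊆ C' ∧ (∃ p ∈ C', p ∉ C) ∧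
      ∀ j, (∃ t ∈ C, x j t ≠ 0) → ∀ t, x j t ≠ 0 → t ∈ C' := by
  classical
  have hp : ∃ p, p ∉ C := by
    by_contra! h
    have : CompactSpace K := ⟨by rwa [← Set.eq_univ_of_forall h]⟩
    exact hσ inferInstance
  obtain ⟨p, hp⟩ := hp
  let A : Set J := {j | ∃ t ∈ C, x j t ≠ 0}
  have hA : A.Countable := by
    obtain ⟨S, -, hS⟩ := aux_unif hx hC
    choose s hs using fun n : ℕ => hS (1 / ((n : ℝ) + 1)) (by positivity)
    refine (Set.countable_iUnion fun n => (s n).countable_toSet).mono ?_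
    rintro j ⟨t, ht, hj⟩
    have h0 : 0 < ‖x j t‖ ^ 2 / 2 := by have := norm_pos_iff.2 hj; positivity
    obtain ⟨n, hn⟩ := exists_nat_one_div_lt h0
    refine Set.mem_iUnion.2 ⟨n, ?_⟩
    by_contra hjs
    have h1 := hs n (s n) subset_rfl t ht
    have h2 := hs n (insert j (s n)) (Finset.subset_insert _ _) t ht
    rw [Finset.sum_insert (by simpa using hjs)] at h2
    rw [abs_lt] at h1 h2
    linarith [h1.1, h1.2, h2.1, h2.2]
  have := hA.to_subtype
  choose F hF hFs using fun j => aux_supp hcc (x j)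
  obtain ⟨D, hD, hFD⟩ := aux_count hcc (fun j : A => F j) (fun j => hF j)
  refine ⟨insert p (C ∪ D), (hC.union hD).insert p, fun t ht => by simp [ht],
    ⟨p, by simp, hp⟩, fun j hj t ht => ?_⟩
  exact Or.inr (Or.inr (hFD ⟨j, hj⟩ (hFs j t ht)))

/-- Let `K` be a locally compact Hausdorff space which is not σ-compact
and such that every countable family of compact subsets of `K` is contained in a single
compact subset. Then there is no standard frame in `C₀(K)`: no index set `J`, family
`(x_j)_{j ∈ J} ⊆ C₀(K)` and constants `c₁, c₂ > 0` satisfy the frame condition. -/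
theorem no_standard_frame {K : Type*} [TopologicalSpace K] [LocallyCompactSpace K]
    [T2Space K]
    (hσ : ¬ SigmaCompactSpace K)
    (hcc : ∀ F : ℕ → Set K, (∀ n, IsCompact (F n)) →
      ∃ C : Set K, IsCompact C ∧ ∀ n, F n ⊆ C) :
    ¬ ∃ (J : Type) (x : J → C₀(K, ℂ)) (c₁ c₂ : ℝ),
        0 < c₁ ∧ 0 < c₂ ∧ IsStandardFrame x c₁ c₂ := by
  classical
  rintro ⟨J, x, c₁, c₂, hc₁, -, hx⟩
  choose! G hG1 hG2 hG3 hG4 using aux_step hσ hcc hx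
  let C : ℕ → Set K := fun n => G^[n] ∅
  have hs : ∀ n, C (n + 1) = G (C n) := fun n => Function.iterate_succ_apply' G n ∅
  have hC : ∀ n, IsCompact (C n) := by
    intro n
    induction n with
    | zero => exact isCompact_empty
    | succ n ih => rw [hs]; exact hG1 _ ih
  have hmono : Monotone C := monotone_nat_of_le_succ fun n => by
    rw [hs]; exact hG2 _ (hC n)
  obtain ⟨D, hD, hCD⟩ := hcc C hC
  obtain ⟨S, hS1, hS⟩ := aux_unif hx hD
  obtain ⟨s, hs'⟩ := hS c₁ hc₁
  have hN : ∀ j, ∃ N, ∀ n, ∀ t ∈ C n, x j t ≠ 0 → t ∈ C N := by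
    intro j
    by_cases h : ∃ n, ∃ t ∈ C n, x j t ≠ 0
    · obtain ⟨n, hn⟩ := h
      refine ⟨n + 1, fun m t _ ht => ?_⟩
      rw [hs]
      exact hG4 _ (hC n) j hn t ht
    · push Not at h
      exact ⟨0, fun n t ht h' => absurd (h n t ht) h'⟩
  choose N hN using hN
  obtain ⟨p, hp, hp'⟩ := hG3 _ (hC (s.sup N))
  rw [← hs] at hp
  have h0 : ∑ j ∈ s, ‖x j p‖ ^ 2 = 0 := by
    refine Finset.sum_eq_zero fun j hj => ?_
    have : x j p = 0 := by
      by_contra h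
      exact hp' (hmono (Finset.le_sup hj) (hN j _ p hp h))
    simp [this]
  have h1 := hs' s subset_rfl p (hCD _ hp)
  rw [h0, sub_zero] at h1
  linarith [hS1 p (hCD _ hp), le_abs_self (S p)]
end
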